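/- For every integer s ≥ 2, the density π_s is strictly positive on the open interval (0, K): π_s(x) > 0 for all x with 0 < x < K. Consequently the measure with density π_s · 1_{(0,K]} has no atoms and its topological support is exactly [0, K]. -/

import Mathlib

open MeasureTheory Real

noncomputable def eulerBeta (a b : ℝ) : ℝ := Real.Gamma a * Real.Gamma b / Real.Gamma (a + b)

noncomputable def Kc (s : ℕ) : ℝ := ((s : ℝ) + 1) ^ (s + 1) / (s : ℝ) ^ s

noncomputable def tauProd {s : ℕ} (t : Fin s → ℝ) : ℝ := ∏ i, t i

def cube (s : ℕ) : Set (Fin s → ℝ) := Set.univ.pi fun _ => Set.Icc (0 : ℝ) 1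

noncomputable def Cnorm (s : ℕ) : ℝ :=
  1 / (eulerBeta (1 / ((s : ℝ) + 1)) (((s : ℝ) - 1) / (2 * (s : ℝ) + 2)) *
      ∏ j ∈ Finset.Icc 2 s,
        eulerBeta ((j : ℝ) / ((s : ℝ) + 1)) ((j : ℝ) / ((s : ℝ) * ((s : ℝ) + 1))))

noncomputable def Fdens (s : ℕ) (t : Fin s → ℝ) : ℝ :=
  Cnorm s * ∏ i : Fin s,
    if (i : ℕ) = 0 then
      t i ^ (1 / ((s : ℝ) + 1) - 1) * (1 - t i) ^ (((s : ℝ) - 1) / (2 * (s : ℝ) + 2) - 1)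
    else
      t i ^ ((((i : ℕ) : ℝ) + 1) / ((s : ℝ) + 1) - 1) *
        (1 - t i) ^ ((((i : ℕ) : ℝ) + 1) / ((s : ℝ) * ((s : ℝ) + 1)) - 1)

noncomputable def piDens (s : ℕ) (x : ℝ) : ℝ :=
  (1 / eulerBeta (1 / 2) (1 / 2 + 1 / (s : ℝ))) *
    ∫ t in cube s,
      if x ≤ tauProd t * Kc s then
        (tauProd t * Kc s - x) ^ (1 / (s : ℝ) - 1 / 2) * x ^ (-(1 : ℝ) / 2) *
          (tauProd t * Kc s) ^ (-(1 : ℝ) / (s : ℝ)) * Fdens s t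
      else 0


noncomputable def wt (a b u : ℝ) : ℝ := u ^ (a - 1) * (1 - u) ^ (b - 1)

noncomputable def muI : Measure ℝ := volume.restrict (Set.Icc (0 : ℝ) 1)

noncomputable def phi (c δ y : ℝ) : ℝ := if c ≤ y then (y - c) ^ δ else 0

instance muI_prob : IsProbabilityMeasure muI := ⟨by simp [muI]⟩

lemma measurable_wt (a b : ℝ) : Measurable (wt a b) := by
  unfold wt; fun_prop

lemma measurable_phi (c δ : ℝ) : Measurable (phi c δ) := by
  unfold phi
  exact Measurable.ite measurableSet_Ici (by fun_prop) (by fun_prop)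

lemma wt_nonneg {a b u : ℝ} (h0 : 0 ≤ u) (h1 : u ≤ 1) : 0 ≤ wt a b u :=
  mul_nonneg (rpow_nonneg h0 _) (rpow_nonneg (by linarith) _)

lemma phi_nonneg {c δ y : ℝ} : 0 ≤ phi c δ y := by
  unfold phi; split_ifs with h
  · exact rpow_nonneg (by linarith) _
  · exact le_rfl

lemma wt_integrable {a b : ℝ} (ha : 0 < a) (hb : 0 < b) : Integrable (wt a b) muI := by
  have h := Complex.betaIntegral_convergent (u := a) (v := b) (by simpa) (by simpa)
  rw [intervalIntegrable_iff_integrableOn_Icc_of_le (by simp)] at h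
  have h2 := h.norm
  refine Integrable.congr h2 ?_
  refine ae_restrict_of_forall_mem measurableSet_Icc (fun x hx ↦ ?_)
  have e1 : ((x : ℂ) ^ ((a : ℂ) - 1)) = ((x ^ (a - 1) : ℝ) : ℂ) := by
    rw [Complex.ofReal_cpow hx.1]; norm_cast
  have e2 : ((1 - (x : ℂ)) ^ ((b : ℂ) - 1)) = (((1 - x) ^ (b - 1) : ℝ) : ℂ) := by
    rw [Complex.ofReal_cpow (by linarith [hx.2])]; norm_cast
  simp only []
  rw [e1, e2, ← Complex.ofReal_mul, Complex.norm_real, Real.norm_of_nonneg]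
  · rfl
  · exact wt_nonneg hx.1 hx.2

/-- one-dimensional bound, uniform in `P` -/
lemma phi_bound {c δ : ℝ} (hc : 0 < c) (hδ : -1 < δ) (hδ0 : δ ≤ 0) :
    ∃ A : ℝ, ∀ P : ℝ, ∫⁻ u, ‖phi c δ (u * P)‖ₑ ∂muI ≤ ‖A‖ₑ := by
  have hI : IntegrableOn (fun u : ℝ => u ^ δ) (Set.Icc 0 1) := by
    rw [← intervalIntegrable_iff_integrableOn_Icc_of_le (by simp)]
    exact intervalIntegral.intervalIntegrable_rpow' hδ
  have hfin : ∫⁻ v in Set.Icc (0:ℝ) 1, ‖v ^ δ‖ₑ ≠ ⊤ := hI.2.ne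
  refine ⟨c ^ δ * (∫⁻ v in Set.Icc (0:ℝ) 1, ‖v ^ δ‖ₑ).toReal, fun P => ?_⟩
  have hr : ‖c ^ δ * (∫⁻ v in Set.Icc (0:ℝ) 1, ‖v ^ δ‖ₑ).toReal‖ₑ
      = ‖c ^ δ‖ₑ * ∫⁻ v in Set.Icc (0:ℝ) 1, ‖v ^ δ‖ₑ := by
    rw [enorm_mul]; congr 1
    rw [Real.enorm_eq_ofReal ENNReal.toReal_nonneg, ENNReal.ofReal_toReal hfin]
  rw [hr]
  let k : ℝ → ENNReal := (Set.Icc (0:ℝ) 1).indicator (fun v => ‖c ^ δ‖ₑ * ‖v ^ δ‖ₑ)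
  have hk : ∫⁻ v, k v = ‖c ^ δ‖ₑ * ∫⁻ v in Set.Icc (0:ℝ) 1, ‖v ^ δ‖ₑ := by
    rw [lintegral_indicator measurableSet_Icc, lintegral_const_mul]
    fun_prop
  rw [← hk, ← lintegral_sub_right_eq_self k (c / P), muI, ← lintegral_indicator measurableSet_Icc]
  refine lintegral_mono fun u => ?_
  by_cases hu : u ∈ Set.Icc (0:ℝ) 1
  swap
  · simp [Set.indicator_of_notMem hu]
  rw [Set.indicator_of_mem hu]
  by_cases hcu : c ≤ u * P
  swap
  · simp [phi, hcu]
  have hu0 : 0 < u := by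
    rcases hu.1.eq_or_lt with h | h
    · rw [← h] at hcu; linarith
    · exact h
  have hP : 0 < P := by
    by_contra hP
    nlinarith [mul_nonneg hu.1 (by linarith : (0:ℝ) ≤ -P)]
  have hPc : c ≤ P := by nlinarith [hu.2]
  have hd : u - c / P = (u * P - c) / P := by field_simp
  have hd0 : 0 ≤ u - c / P := by rw [hd]; exact div_nonneg (by linarith) hP.le
  have hd1 : u - c / P ≤ 1 := by linarith [hu.2, div_pos hc hP]
  simp only [k]
  have hmem : u - c / P ∈ Set.Icc (0:ℝ) 1 := ⟨hd0, hd1⟩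
  rw [Set.indicator_of_mem hmem, ← enorm_mul, phi, if_pos hcu]
  rw [Real.enorm_eq_ofReal (rpow_nonneg (by linarith) _), Real.enorm_eq_ofReal
    (mul_nonneg (rpow_nonneg hc.le _) (rpow_nonneg hd0 _))]
  apply ENNReal.ofReal_le_ofReal
  have : u * P - c = P * (u - c / P) := by field_simp
  rw [this, mul_rpow hP.le hd0]
  exact mul_le_mul_of_nonneg_right (rpow_le_rpow_of_nonpos hc hPc hδ0) (rpow_nonneg hd0 _)

lemma measurable_tau {s : ℕ} : Measurable (fun t : Fin s → ℝ => tauProd t) := by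
  unfold tauProd; fun_prop

lemma piece_integrable {s : ℕ} {c δ : ℝ} (hc : 0 < c) (hδ : -1 < δ) (hδ0 : δ ≤ 0)
    (i : Fin s) (V : Fin s → ℝ → ℝ) (hVm : ∀ j, Measurable (V j))
    (hV : ∀ j, Integrable (V j) muI) (hVi : ∀ u, V i u = 1) :
    Integrable (fun t : Fin s → ℝ => phi c δ (tauProd t) * ∏ j, V j (t j))
      (Measure.pi fun _ => muI) := by
  obtain ⟨A, hA⟩ := phi_bound hc hδ hδ0
  have hg : Integrable (fun t : Fin s → ℝ => A * ∏ j, V j (t j)) (Measure.pi fun _ => muI) :=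
    (Integrable.fintype_prod hV).const_mul A
  have hpm : Measurable (fun t : Fin s → ℝ => ∏ j, V j (t j)) := by fun_prop
  have hqm : Measurable (fun t : Fin s → ℝ => phi c δ (tauProd t) * ∏ j, V j (t j)) :=
    ((measurable_phi c δ).comp measurable_tau).mul hpm
  refine ⟨hqm.aestronglyMeasurable, lt_of_le_of_lt ?_ hg.2⟩
  refine lintegral_le_of_lmarginal_le {i} hqm.enorm (hpm.const_mul A).enorm ?_
  rw [lmarginal_singleton, lmarginal_singleton]
  intro t
  have e1 : ∀ u, ∏ j, V j (Function.update t i u j) = ∏ j, V j (t j) := by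
    intro u
    refine Finset.prod_congr rfl fun j _ => ?_
    by_cases h : j = i
    · subst h; rw [hVi, hVi]
    · rw [Function.update_of_ne h]
  have e2 : ∀ u, tauProd (Function.update t i u) = u * ∏ x ∈ Finset.univ \ {i}, t x := fun u =>
    Finset.prod_update_of_mem (Finset.mem_univ i) t u
  simp only [e1, e2, enorm_mul]
  rw [lintegral_mul_const _ (by
    exact ((measurable_phi c δ).comp (measurable_id.mul_const _)).enorm), lintegral_const]
  simp only [measure_univ, mul_one]
  gcongr
  exact hA _

lemma cube_measure (s : ℕ) :
    (volume : Measure (Fin s → ℝ)).restrict (cube s) = Measure.pi fun _ => muI := by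
  rw [cube, volume_pi, Measure.restrict_pi_pi]; rfl

lemma measurableSet_cube (s : ℕ) : MeasurableSet (cube s) :=
  MeasurableSet.univ_pi fun _ => measurableSet_Icc

lemma tau_le {s : ℕ} {t : Fin s → ℝ} (ht : t ∈ cube s) (i : Fin s) : tauProd t ≤ t i := by
  have h := fun j => ht j (Set.mem_univ j)
  unfold tauProd
  rw [← Finset.mul_prod_erase Finset.univ t (Finset.mem_univ i)]
  have : ∏ x ∈ Finset.univ.erase i, t x ≤ 1 :=
    Finset.prod_le_one (fun j _ => (h j).1) (fun j _ => (h j).2)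
  exact mul_le_of_le_one_right (h i).1 this

lemma exists_r {s : ℕ} {c : ℝ} (hc1 : c < 1) (hc : 0 < c) : ∃ r : ℝ, 0 < r ∧ r < 1 ∧ c < r ^ s := by
  have hs : (0:ℝ) < (s:ℝ) + 1 := by positivity
  refine ⟨1 + -((1 - c) / (s + 1)), ?_, ?_, ?_⟩
  · have : (1 - c) / ((s:ℝ) + 1) < 1 := by
      rw [div_lt_one hs]; have : (0:ℝ) ≤ s := by positivity
      linarith
    linarith
  · have : 0 < (1 - c) / ((s:ℝ) + 1) := div_pos (by linarith) hs
    linarith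
  · have h1 : (1 - c) / ((s:ℝ) + 1) ≤ 1 := by
      rw [div_le_one hs]; have : (0:ℝ) ≤ s := by positivity
      linarith
    refine lt_of_lt_of_le ?_ (one_add_mul_le_pow (by linarith) s)
    have : 0 < (1 - c) / ((s:ℝ) + 1) := div_pos (by linarith) hs
    have e : (s + 1) * ((1 - c) / ((s:ℝ) + 1)) = 1 - c := by field_simp
    nlinarith

lemma main_integrable {s : ℕ} {c δ : ℝ} (hc : 0 < c) (hc1 : c < 1) (hδ : -1 < δ) (hδ0 : δ ≤ 0)
    (a b : Fin s → ℝ) (ha : ∀ i, 0 < a i) (ha1 : ∀ i, a i ≤ 1) (hb : ∀ i, 0 < b i)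
    (hb1 : ∀ i, b i ≤ 1) :
    Integrable (fun t : Fin s → ℝ => phi c δ (tauProd t) * ∏ j, wt (a j) (b j) (t j))
      (Measure.pi fun _ => muI) := by
  obtain ⟨r, hr0, hr1, hrc⟩ := exists_r (s := s) hc1 hc
  let V : Fin s → Fin s → ℝ → ℝ := fun i j => if j = i then fun _ => 1 else wt (a j) (b j)
  have hV : ∀ i, Integrable (fun t : Fin s → ℝ => phi c δ (tauProd t) * ∏ j, V i j (t j))
      (Measure.pi fun _ => muI) := by
    intro i
    refine piece_integrable hc hδ hδ0 i (V i) ?_ ?_ ?_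
    · intro j; by_cases h : j = i
      · simp [V, h]
      · simp [V, h, measurable_wt]
    · intro j; by_cases h : j = i
      · simp [V, h]
      · simp [V, h, wt_integrable (ha j) (hb j)]
    · simp [V]
  have hW : Integrable (fun t : Fin s → ℝ => (r ^ s - c) ^ δ * ∏ j, wt (a j) (b j) (t j))
      (Measure.pi fun _ => muI) :=
    (Integrable.fintype_prod fun j => wt_integrable (ha j) (hb j)).const_mul _
  have hS := hW.add (integrable_finsetSum Finset.univ fun i _ =>
    (hV i).const_mul (c ^ (a i - 1) * (1 - r) ^ (b i - 1)))
  have hm : Measurable (fun t : Fin s → ℝ => phi c δ (tauProd t) * ∏ j, wt (a j) (b j) (t j)) := by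
    refine ((measurable_phi c δ).comp measurable_tau).mul ?_
    exact Finset.measurable_prod _ fun j _ => (measurable_wt _ _).comp (measurable_pi_apply j)
  refine hS.mono' hm.aestronglyMeasurable ?_
  rw [← cube_measure]
  refine ae_restrict_of_forall_mem (measurableSet_cube s) fun t ht => ?_
  have h := fun j => ht j (Set.mem_univ j)
  have hw : ∀ j, 0 ≤ wt (a j) (b j) (t j) := fun j => wt_nonneg (h j).1 (h j).2
  have hpw : 0 ≤ ∏ j, wt (a j) (b j) (t j) := Finset.prod_nonneg fun j _ => hw j
  have hVn : ∀ i j, 0 ≤ V i j (t j) := by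
    intro i j; by_cases h : j = i
    · simp [V, h]
    · simp [V, h, hw]
  have hT : ∀ i, 0 ≤ (c ^ (a i - 1) * (1 - r) ^ (b i - 1)) *
      (phi c δ (tauProd t) * ∏ j, V i j (t j)) := fun i =>
    mul_nonneg (mul_nonneg (rpow_nonneg hc.le _) (rpow_nonneg (by linarith) _))
      (mul_nonneg phi_nonneg (Finset.prod_nonneg fun j _ => hVn i j))
  have hF : 0 ≤ (r ^ s - c) ^ δ * ∏ j, wt (a j) (b j) (t j) :=
    mul_nonneg (rpow_nonneg (by linarith) _) hpw
  rw [Real.norm_of_nonneg (mul_nonneg phi_nonneg hpw)]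
  simp only [Pi.add_apply]
  by_cases hct : c ≤ tauProd t
  swap
  · have : phi c δ (tauProd t) = 0 := by simp [phi, hct]
    rw [this, zero_mul]
    exact add_nonneg hF (Finset.sum_nonneg fun i _ => by simpa [this] using hT i)
  by_cases hall : ∀ j, r ≤ t j
  · have h1 : r ^ s ≤ tauProd t := by
      have := Finset.prod_le_prod (s := Finset.univ) (f := fun _ : Fin s => r) (g := t)
        (fun _ _ => hr0.le) (fun j _ => hall j)
      simpa [tauProd] using this
    have h2 : phi c δ (tauProd t) ≤ (r ^ s - c) ^ δ := by
      rw [phi, if_pos hct]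
      exact rpow_le_rpow_of_nonpos (by linarith) (by linarith) hδ0
    have h3 := mul_le_mul_of_nonneg_right h2 hpw
    have h4 := Finset.sum_nonneg fun i (_ : i ∈ Finset.univ) => hT i
    simp only [Finset.sum_apply] at *
    linarith
  · push Not at hall
    obtain ⟨i, hi⟩ := hall
    have hci : c ≤ t i := hct.trans (tau_le ht i)
    have hb' : wt (a i) (b i) (t i) ≤ c ^ (a i - 1) * (1 - r) ^ (b i - 1) := by
      refine mul_le_mul (rpow_le_rpow_of_nonpos hc hci (by linarith [ha1 i]))
        (rpow_le_rpow_of_nonpos (by linarith) (by linarith) (by linarith [hb1 i]))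
        (rpow_nonneg (by linarith) _) (rpow_nonneg hc.le _)
    have e : ∏ j, wt (a j) (b j) (t j) = wt (a i) (b i) (t i) * ∏ j, V i j (t j) := by
      rw [← Finset.mul_prod_erase _ _ (Finset.mem_univ i),
        ← Finset.mul_prod_erase _ (fun j => V i j (t j)) (Finset.mem_univ i)]
      simp only [V, if_true, one_mul]
      congr 1
      refine Finset.prod_congr rfl fun j hj => ?_
      simp [Finset.ne_of_mem_erase hj]
    have h5 : phi c δ (tauProd t) * ∏ j, wt (a j) (b j) (t j) ≤
        (c ^ (a i - 1) * (1 - r) ^ (b i - 1)) * (phi c δ (tauProd t) * ∏ j, V i j (t j)) := by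
      rw [e, mul_left_comm]
      exact mul_le_mul_of_nonneg_right hb'
        (mul_nonneg phi_nonneg (Finset.prod_nonneg fun j _ => hVn i j))
    have h6 := Finset.single_le_sum (fun i (_ : i ∈ Finset.univ) => hT i) (Finset.mem_univ i)
    linarith

noncomputable def aE (s : ℕ) (i : Fin s) : ℝ := (((i : ℕ) : ℝ) + 1) / ((s : ℝ) + 1)

noncomputable def bE (s : ℕ) (i : Fin s) : ℝ :=
  if (i : ℕ) = 0 then ((s : ℝ) - 1) / (2 * (s : ℝ) + 2)
  else (((i : ℕ) : ℝ) + 1) / ((s : ℝ) * ((s : ℝ) + 1))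

lemma Fdens_eq (s : ℕ) (t : Fin s → ℝ) :
    Fdens s t = Cnorm s * ∏ i, wt (aE s i) (bE s i) (t i) := by
  unfold Fdens
  congr 1
  refine Finset.prod_congr rfl fun i _ => ?_
  unfold wt aE bE
  split_ifs with h
  · simp [h]
  · rfl

lemma eulerBeta_pos {a b : ℝ} (ha : 0 < a) (hb : 0 < b) : 0 < eulerBeta a b :=
  ProbabilityTheory.beta_pos ha hb

lemma Cnorm_pos (s : ℕ) (hs : 2 ≤ s) : 0 < Cnorm s := by
  have h2 : (2:ℝ) ≤ s := by exact_mod_cast hs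
  unfold Cnorm
  refine one_div_pos.2 (mul_pos (eulerBeta_pos (by positivity)
    (div_pos (by linarith) (by linarith))) (Finset.prod_pos fun j hj => ?_))
  have hj2 : (0:ℝ) < j := by
    have := (Finset.mem_Icc.1 hj).1
    exact_mod_cast (by omega : 0 < j)
  exact eulerBeta_pos (by positivity) (by positivity)

lemma Kc_pos (s : ℕ) (hs : 2 ≤ s) : 0 < Kc s := by
  have h2 : (0:ℝ) < s := by exact_mod_cast (by omega : 0 < s)
  unfold Kc; positivity

noncomputable def hI (s : ℕ) (x : ℝ) (t : Fin s → ℝ) : ℝ :=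
      if x ≤ tauProd t * Kc s then
        (tauProd t * Kc s - x) ^ (1 / (s : ℝ) - 1 / 2) * x ^ (-(1 : ℝ) / 2) *
          (tauProd t * Kc s) ^ (-(1 : ℝ) / (s : ℝ)) * Fdens s t
      else 0

lemma measurable_hI (s : ℕ) : Measurable (fun p : ℝ × (Fin s → ℝ) => hI s p.1 p.2) := by
  have hτ : Measurable (fun p : ℝ × (Fin s → ℝ) => tauProd p.2 * Kc s) :=
    (measurable_tau.comp measurable_snd).mul_const _
  have hF : Measurable (fun p : ℝ × (Fin s → ℝ) => Fdens s p.2) := by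
    simp only [Fdens_eq]
    refine Measurable.const_mul ?_ _
    exact Finset.measurable_prod _ fun j _ =>
      (measurable_wt _ _).comp ((measurable_pi_apply j).comp measurable_snd)
  unfold hI
  refine Measurable.ite (measurableSet_le measurable_fst hτ) ?_ measurable_const
  exact ((((hτ.sub measurable_fst).pow_const _).mul (measurable_fst.pow_const _)).mul
    (hτ.pow_const _)).mul hF

lemma measurable_piDens (s : ℕ) : Measurable (piDens s) := by
  have := (measurable_hI s).stronglyMeasurable.integral_prod_right'
    (ν := (volume : Measure (Fin s → ℝ)).restrict (cube s))
  exact this.measurable.const_mul _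

lemma hI_nonneg (s : ℕ) (hs : 2 ≤ s) {x : ℝ} (hx : 0 < x) {t : Fin s → ℝ} (ht : t ∈ cube s) :
    0 ≤ hI s x t := by
  have h := fun j => ht j (Set.mem_univ j)
  unfold hI
  split_ifs with hc
  · rw [Fdens_eq]
    refine mul_nonneg (mul_nonneg (mul_nonneg (rpow_nonneg (by linarith) _) (rpow_nonneg hx.le _))
      (rpow_nonneg (by linarith) _)) (mul_nonneg (Cnorm_pos s hs).le
      (Finset.prod_nonneg fun j _ => wt_nonneg (h j).1 (h j).2))
  · exact le_rfl

lemma hI_integrable (s : ℕ) (hs : 2 ≤ s) {x : ℝ} (hx : 0 < x) (hxK : x < Kc s) :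
    IntegrableOn (hI s x) (cube s) := by
  have hK := Kc_pos s hs
  have h2 : (2:ℝ) ≤ s := by exact_mod_cast hs
  have hsi : 1 / (s:ℝ) ≤ 1 / 2 := one_div_le_one_div_of_le (by norm_num) h2
  have hsi0 : 0 < 1 / (s:ℝ) := by positivity
  have hfin : ∀ i : Fin s, ((i : ℕ) : ℝ) + 1 ≤ s := fun i => by exact_mod_cast i.2
  have hmain := main_integrable (s := s) (c := x / Kc s) (δ := 1 / (s:ℝ) - 1 / 2)
    (div_pos hx hK) ((div_lt_one hK).2 hxK) (by linarith) (by linarith) (aE s) (bE s)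
    (fun i => by unfold aE; positivity)
    (fun i => by unfold aE; rw [div_le_one (by linarith)]; linarith [hfin i])
    (fun i => by
      unfold bE; split_ifs
      · exact div_pos (by linarith) (by linarith)
      · positivity)
    (fun i => by
      unfold bE; split_ifs
      · rw [div_le_one (by linarith)]; linarith
      · rw [div_le_one (by positivity)]; nlinarith [hfin i])
  rw [← cube_measure] at hmain
  have hm2 := hmain.const_mul
    (Kc s ^ (1 / (s:ℝ) - 1 / 2) * x ^ (-(1 : ℝ) / 2) * x ^ (-(1 : ℝ) / (s : ℝ)) * Cnorm s)
  refine hm2.mono' ((measurable_hI s).comp (measurable_const.prodMk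
    measurable_id)).aestronglyMeasurable ?_
  refine ae_restrict_of_forall_mem (measurableSet_cube s) fun t ht => ?_
  have h := fun j => ht j (Set.mem_univ j)
  rw [Real.norm_of_nonneg (hI_nonneg s hs hx ht)]
  have hpw : 0 ≤ ∏ j, wt (aE s j) (bE s j) (t j) :=
    Finset.prod_nonneg fun j _ => wt_nonneg (h j).1 (h j).2
  have hC := Cnorm_pos s hs
  unfold hI
  split_ifs with hc
  · have hc' : x / Kc s ≤ tauProd t := by rwa [div_le_iff₀ hK]
    rw [phi, if_pos hc', Fdens_eq]
    have e : tauProd t * Kc s - x = Kc s * (tauProd t - x / Kc s) := by field_simp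
    have h3 : (tauProd t * Kc s) ^ (-(1 : ℝ) / (s : ℝ)) ≤ x ^ (-(1 : ℝ) / (s : ℝ)) :=
      rpow_le_rpow_of_nonpos hx hc (by rw [neg_div]; linarith)
    rw [e, mul_rpow hK.le (by linarith)]
    have p1 := rpow_nonneg hK.le (1 / (s:ℝ) - 1 / 2)
    have p2 := rpow_nonneg hx.le (-(1 : ℝ) / 2)
    have p3 : 0 ≤ (tauProd t - x / Kc s) ^ (1 / (s:ℝ) - 1 / 2) := rpow_nonneg (by linarith) _
    calc _ ≤ Kc s ^ (1 / (s:ℝ) - 1 / 2) * (tauProd t - x / Kc s) ^ (1 / (s:ℝ) - 1 / 2)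
          * x ^ (-(1 : ℝ) / 2) * x ^ (-(1 : ℝ) / (s : ℝ))
          * (Cnorm s * ∏ j, wt (aE s j) (bE s j) (t j)) := by gcongr
      _ = _ := by ring
  · have := phi_nonneg (c := x / Kc s) (δ := 1 / (s:ℝ) - 1 / 2) (y := tauProd t)
    have p1 := rpow_nonneg hK.le (1 / (s:ℝ) - 1 / 2)
    have p2 := rpow_nonneg hx.le (-(1 : ℝ) / 2)
    have p3 := rpow_nonneg hx.le (-(1 : ℝ) / s)
    positivity

lemma piDens_pos (s : ℕ) (hs : 2 ≤ s) {x : ℝ} (hx : 0 < x) (hxK : x < Kc s) :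
    0 < piDens s x := by
  have hK := Kc_pos s hs
  have h2 : (2:ℝ) ≤ s := by exact_mod_cast hs
  refine mul_pos (one_div_pos.2 (eulerBeta_pos (by norm_num) (by positivity))) ?_
  change 0 < ∫ t in cube s, hI s x t
  rw [setIntegral_pos_iff_support_of_nonneg_ae
    (ae_restrict_of_forall_mem (measurableSet_cube s) fun t ht => hI_nonneg s hs hx ht)
    (hI_integrable s hs hx hxK)]
  obtain ⟨r, hr0, hr1, hrc⟩ := exists_r (s := s) (c := x / Kc s) ((div_lt_one hK).2 hxK)
    (div_pos hx hK)
  let B : Set (Fin s → ℝ) := Set.univ.pi fun _ => Set.Ioo r 1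
  have hBo : IsOpen B := isOpen_set_pi Set.finite_univ fun _ _ => isOpen_Ioo
  have hBn : B.Nonempty := ⟨fun _ => (r + 1) / 2, fun i _ => ⟨by linarith, by linarith⟩⟩
  refine lt_of_lt_of_le (hBo.measure_pos volume hBn) (measure_mono fun t ht => ?_)
  have h : ∀ j, r < t j ∧ t j < 1 := fun j => ht j (Set.mem_univ j)
  refine ⟨?_, fun j _ => ⟨by linarith [(h j).1], (h j).2.le⟩⟩
  have h1 : r ^ s ≤ tauProd t := by
    have := Finset.prod_le_prod (s := Finset.univ) (f := fun _ : Fin s => r) (g := t)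
      (fun _ _ => hr0.le) (fun j _ => (h j).1.le)
    simpa [tauProd] using this
  have hlt : x < tauProd t * Kc s := by
    rw [← div_lt_iff₀ hK]; linarith
  rw [Function.mem_support, hI, if_pos hlt.le, Fdens_eq]
  refine ne_of_gt (mul_pos (mul_pos (mul_pos (rpow_pos_of_pos (by linarith) _) (rpow_pos_of_pos hx _))
      (rpow_pos_of_pos (by linarith) _)) (mul_pos (Cnorm_pos s hs)
      (Finset.prod_pos fun j _ => mul_pos (rpow_pos_of_pos (by linarith [(h j).1]) _)
        (rpow_pos_of_pos (by linarith [(h j).2]) _))))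

/-- For every integer `s ≥ 2`, the density `π_s` is strictly positive on
`(0, K)`. Consequently the measure with density `π_s · 1_{(0,K]}` has no atoms and its
topological support (the set of points all of whose open neighbourhoods have positive
measure) is exactly `[0, K]`. -/
theorem piDens_pos_and_support (s : ℕ) (hs : 2 ≤ s) :
    (∀ x : ℝ, 0 < x → x < Kc s → 0 < piDens s x) ∧
    (∀ x : ℝ,
      volume.withDensity
        (fun x => ENNReal.ofReal ((Set.Ioc (0 : ℝ) (Kc s)).indicator (piDens s) x)) {x} = 0) ∧
    {x : ℝ | ∀ U : Set ℝ, IsOpen U → x ∈ U →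
        0 < volume.withDensity
          (fun x => ENNReal.ofReal ((Set.Ioc (0 : ℝ) (Kc s)).indicator (piDens s) x)) U} =
      Set.Icc (0 : ℝ) (Kc s) := by
  have hK := Kc_pos s hs
  have hmeas : Measurable
      (fun x => ENNReal.ofReal ((Set.Ioc (0 : ℝ) (Kc s)).indicator (piDens s) x)) :=
    ((measurable_piDens s).indicator measurableSet_Ioc).ennreal_ofReal
  refine ⟨fun x hx hxK => piDens_pos s hs hx hxK, fun x => ?_, ?_⟩
  · exact withDensity_absolutelyContinuous _ _ (by simp)
  · ext x
    constructor
    · intro h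
      by_contra hx
      refine (h (Set.Icc (0:ℝ) (Kc s))ᶜ isClosed_Icc.isOpen_compl hx).ne' ?_
      rw [withDensity_apply_eq_zero hmeas]
      convert measure_empty (μ := (volume : Measure ℝ))
      ext y
      simp only [Set.mem_inter_iff, Set.mem_empty_iff_false, iff_false, not_and]
      intro hy hy2
      apply hy
      have : y ∉ Set.Ioc (0:ℝ) (Kc s) := fun h' => hy2 ⟨h'.1.le, h'.2⟩
      simp [Set.indicator_of_notMem this]
    · intro hx U hU hxU
      rw [pos_iff_ne_zero, Ne, withDensity_apply_eq_zero hmeas]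
      rw [← closure_Ioo hK.ne] at hx
      have hne := mem_closure_iff.1 hx U hU hxU
      have hpos := (hU.inter isOpen_Ioo).measure_pos volume hne
      refine (lt_of_lt_of_le hpos (measure_mono ?_)).ne'
      intro y hy
      refine ⟨?_, hy.1⟩
      have hy' : y ∈ Set.Ioc (0:ℝ) (Kc s) := ⟨hy.2.1, hy.2.2.le⟩
      have := piDens_pos s hs hy.2.1 hy.2.2
      simp [Set.indicator_of_mem hy', this]
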